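/- Suppose the factor graph of f is a tree: the simple graph on the vertex set (Fin n) ⊕ A, in which a variable vertex i is adjacent to a factor vertex α exactly when i ∈ α (and there are no other edges), is connected and acyclic. Let b be a vector of beliefs that is admissible for f with all parameters equal to 1 (c_i = 1 for all i and c_α = 1 for all α) and min-consistent. If the beliefs admit a unique estimate x*, then x* is a global minimum of f: f(x*) ≤ f(x) for all x. -/

import Mathlib

/-- In a tree rooted at `r`, every vertex `v ≠ r` has a unique neighbour closer to the root. -/
theorem SimpleGraph.IsTree.existsUnique_adj_dist_eq_add_one {V : Type*} {G : SimpleGraph V}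
    (hG : G.IsTree) {r v : V} (hv : v ≠ r) :
    ∃! w, G.Adj v w ∧ G.dist r v = G.dist r w + 1 := by
  have penultimate_eq : ∀ p : G.Walk r v, p.IsPath →
      ∀ w, G.Adj v w → G.dist r v = G.dist r w + 1 → w = p.penultimate := by
    intro p hp w hvw hd
    obtain ⟨q, hq⟩ := hG.connected.exists_walk_length_eq_dist r w
    have hpath : (q.concat hvw.symm).IsPath := by
      apply SimpleGraph.Walk.isPath_of_length_eq_dist
      rw [SimpleGraph.Walk.length_concat, hq, hd]
    have hpq := (hG.existsUnique_path r v).unique hp hpath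
    rw [hpq, SimpleGraph.Walk.penultimate_concat]
  obtain ⟨p, hp, hlen⟩ := hG.connected.exists_path_of_dist r v
  have hnil : ¬ p.Nil := SimpleGraph.Walk.not_nil_of_ne hv.symm
  refine ⟨p.penultimate, ⟨(p.adj_penultimate hnil).symm, ?_⟩,
    fun w hw => penultimate_eq p hp w hw.1 hw.2⟩
  have hle := SimpleGraph.dist_le p.dropLast
  have hdrop : p.dropLast.length + 1 = p.length := SimpleGraph.Walk.length_dropLast_add_one hnil
  rcases hG.dist_eq_dist_add_one_of_adj r (p.adj_penultimate hnil) with h | h <;> omega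

/-- Rooting a factor tree at a variable `r` selects a parent variable in each factor, so that every
variable other than `r` is a non-parent member of exactly one factor, and `r` of none. -/
theorem exists_parent_of_isTree {ι : Type*} {A : Finset (Finset ι)}
    {G : SimpleGraph (ι ⊕ {α : Finset ι // α ∈ A})} (hG : G.IsTree)
    (hadj : ∀ i α, G.Adj (Sum.inl i) (Sum.inr α) ↔ i ∈ α.1)
    (hvar : ∀ i j, ¬ G.Adj (Sum.inl i) (Sum.inl j))
    (hfac : ∀ α β, ¬ G.Adj (Sum.inr α) (Sum.inr β)) (r : ι) :
    ∃ p : Finset ι → ι, (∀ α ∈ A, p α ∈ α) ∧ (∀ α ∈ A, r ∈ α → r = p α) ∧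
      ∀ k, k ≠ r → ∃! α, α ∈ A ∧ k ∈ α ∧ k ≠ p α := by
  have hpar : ∀ α : Finset ι, ∃ i, ∀ hα : α ∈ A, i ∈ α ∧ ∀ k ∈ α, k = i ↔
      G.dist (Sum.inl r) (Sum.inr ⟨α, hα⟩) = G.dist (Sum.inl r) (Sum.inl k) + 1 := by
    intro α
    by_cases hα : α ∈ A
    · obtain ⟨w, ⟨hw, hd⟩, huniq⟩ := hG.existsUnique_adj_dist_eq_add_one
        (r := Sum.inl r) (v := Sum.inr ⟨α, hα⟩) (by simp)
      rcases w with i | β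
      · refine ⟨i, fun _ => ⟨(hadj _ _).1 hw.symm, fun k hk => ⟨?_, fun h => ?_⟩⟩⟩
        · rintro rfl
          exact hd
        · exact Sum.inl_injective (huniq _ ⟨((hadj k ⟨α, hα⟩).2 hk).symm, h⟩)
      · exact absurd hw (hfac _ _)
    · exact ⟨r, fun h => absurd h hα⟩
  choose p hp using hpar
  have nonparent_iff : ∀ α (hα : α ∈ A), ∀ k ∈ α, k ≠ p α ↔
      G.dist (Sum.inl r) (Sum.inl k) = G.dist (Sum.inl r) (Sum.inr ⟨α, hα⟩) + 1 := by
    intro α hα k hk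
    rw [Ne, (hp α hα).2 k hk]
    rcases hG.dist_eq_dist_add_one_of_adj (Sum.inl r) ((hadj k ⟨α, hα⟩).2 hk) with h | h <;> omega
  refine ⟨p, fun α hα => (hp α hα).1, fun α hα hr => ?_, fun k hk => ?_⟩
  · by_contra h
    have := (nonparent_iff α hα r hr).1 h
    rw [SimpleGraph.dist_self] at this
    omega
  · obtain ⟨w, ⟨hw, hd⟩, huniq⟩ := hG.existsUnique_adj_dist_eq_add_one
      (r := Sum.inl r) (v := Sum.inl k) (by simpa using hk)
    rcases w with i | ⟨α, hα⟩
    · exact absurd hw (hvar _ _)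
    · have hkα : k ∈ α := (hadj _ _).1 hw
      refine ⟨α, ⟨hα, hkα, (nonparent_iff α hα k hkα).2 hd⟩, ?_⟩
      rintro β ⟨hβ, hkβ, hne⟩
      have := huniq (Sum.inr ⟨β, hβ⟩) ⟨(hadj k ⟨β, hβ⟩).2 hkβ, (nonparent_iff β hβ k hkβ).1 hne⟩
      exact congrArg Subtype.val (Sum.inr_injective this)

/-- If every index other than `r` is a non-parent member of exactly one factor and `r` of none, then
the parents account for all the excess of the sum over factors over the sum over indices. -/
theorem sum_add_sum_parent_eq {ι M : Type*} [Fintype ι] [AddCommMonoid M]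
    (A : Finset (Finset ι)) (r : ι) (p : Finset ι → ι) (hp : ∀ α ∈ A, p α ∈ α)
    (hr : ∀ α ∈ A, r ∈ α → r = p α)
    (huniq : ∀ k, k ≠ r → ∃! α, α ∈ A ∧ k ∈ α ∧ k ≠ p α) (g : ι → M) :
    ∑ i, g i + ∑ α ∈ A, g (p α) = g r + ∑ α ∈ A, ∑ k ∈ α, g k := by
  classical
  have hsplit : ∑ α ∈ A, ∑ k ∈ α, g k = ∑ α ∈ A, g (p α) + ∑ α ∈ A, ∑ k ∈ α.erase (p α), g k := by
    rw [← Finset.sum_add_distrib]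
    exact Finset.sum_congr rfl fun α hα => (Finset.add_sum_erase _ _ (hp α hα)).symm
  have hnonparent : ∑ α ∈ A, ∑ k ∈ α.erase (p α), g k = ∑ k ∈ Finset.univ.erase r, g k := by
    rw [Finset.sum_comm' (t' := Finset.univ.erase r)
      (s' := fun k => A.filter fun α => k ∈ α ∧ k ≠ p α)]
    · refine Finset.sum_congr rfl fun k hk => ?_
      obtain ⟨α, hα, hα'⟩ := huniq k (Finset.ne_of_mem_erase hk)
      have hsingle : (A.filter fun α => k ∈ α ∧ k ≠ p α) = {α} := by
        ext β
        simp only [Finset.mem_filter, Finset.mem_singleton]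
        refine ⟨hα' β, ?_⟩
        rintro rfl
        exact hα
      rw [hsingle, Finset.sum_singleton]
    · intro α k
      simp only [Finset.mem_erase, Finset.mem_filter, Finset.mem_univ, and_true]
      constructor
      · rintro ⟨hα, hne, hk⟩
        refine ⟨⟨hα, hk, hne⟩, ?_⟩
        rintro rfl
        exact hne (hr α hα hk)
      · rintro ⟨⟨hα, hk, hne⟩, -⟩
        exact ⟨hα, hne, hk⟩
  rw [hsplit, hnonparent, ← Finset.add_sum_erase _ g (Finset.mem_univ r)]
  abel

section MinConsistent

variable {ι X : Type*} [Finite ι] [Finite X] {B : (ι → X) → ℝ} {i : ι} {c : ℝ} {b : X → ℝ}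

/-- A min-consistent factor belief dominates its variable beliefs. -/
theorem const_add_le_of_sInf_eq
    (hmin : ∀ t, sInf {r : ℝ | ∃ x : ι → X, x i = t ∧ B x = r} = c + b t) (x : ι → X) :
    c + b (x i) ≤ B x := by
  rw [← hmin]
  refine csInf_le (Set.Finite.bddBelow ((Set.finite_range B).subset ?_)) ⟨x, rfl, rfl⟩
  rintro _ ⟨y, -, rfl⟩
  exact ⟨y, rfl⟩

/-- The minimum of a min-consistent factor belief with a prescribed coordinate is attained. -/
theorem exists_eq_const_add_of_sInf_eq
    (hmin : ∀ t, sInf {r : ℝ | ∃ x : ι → X, x i = t ∧ B x = r} = c + b t) (t : X) :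
    ∃ x : ι → X, x i = t ∧ B x = c + b t := by
  rw [← hmin]
  have hne : {r : ℝ | ∃ x : ι → X, x i = t ∧ B x = r}.Nonempty := ⟨_, fun _ => t, rfl, rfl⟩
  refine hne.csInf_mem ((Set.finite_range B).subset ?_)
  rintro _ ⟨y, -, rfl⟩
  exact ⟨y, rfl⟩

end MinConsistent

/-- If the variable beliefs of a min-consistent factor belief have unique minimizers `xs`, then `xs`
minimizes the factor belief. -/
theorem le_of_minConsistent {ι X : Type*} [Finite ι] [Finite X]
    {α : Finset ι} {B : (ι → X) → ℝ} {b : ι → X → ℝ}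
    (hdep : ∀ x y : ι → X, (∀ i ∈ α, x i = y i) → B x = B y)
    (hmc : ∀ i ∈ α, ∃ c : ℝ, ∀ t : X,
      sInf {r : ℝ | ∃ x : ι → X, x i = t ∧ B x = r} = c + b i t)
    {xs : ι → X} (hxs : ∀ i : ι, ∀ y : X, y ≠ xs i → b i (xs i) < b i y) (x : ι → X) :
    B xs ≤ B x := by
  have : Nonempty (ι → X) := ⟨xs⟩
  obtain ⟨y, hy⟩ := Finite.exists_min B
  rw [hdep xs y]
  · exact hy x
  · intro i hi
    by_contra hne
    obtain ⟨c, hc⟩ := hmc i hi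
    obtain ⟨z, -, hz⟩ := exists_eq_const_add_of_sInf_eq hc (xs i)
    have := const_add_le_of_sInf_eq hc y
    have := hxs i (y i) (Ne.symm hne)
    have := hy z
    linarith

/-- If the factor graph of `f` is a tree, the beliefs are
admissible (with all parameters equal to `1`) and min-consistent, and they
admit a unique estimate `x*`, then `x*` is a global minimum of `f`. -/
theorem min_sum_correct_on_trees
    {X : Type} [Fintype X] [Nonempty X] {n : ℕ}
    (A : Finset (Finset (Fin n))) (hAne : ∀ α ∈ A, α.Nonempty)
    (φ : Fin n → X → ℝ) (ψ : Finset (Fin n) → (Fin n → X) → ℝ)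
    (hψ : ∀ α ∈ A, ∀ x y : Fin n → X, (∀ i ∈ α, x i = y i) → ψ α x = ψ α y)
    (f : (Fin n → X) → ℝ)
    (hf : ∀ x, f x = ∑ i, φ i (x i) + ∑ α ∈ A, ψ α x)
    -- the factor graph is a tree:
    (hTree : (SimpleGraph.fromRel
      (fun u v : Fin n ⊕ {α : Finset (Fin n) // α ∈ A} =>
        match u, v with
        | Sum.inl i, Sum.inr α => i ∈ α.1
        | _, _ => False)).IsTree)
    (bv : Fin n → X → ℝ) (bf : Finset (Fin n) → (Fin n → X) → ℝ)
    (hbfdep : ∀ α ∈ A, ∀ x y : Fin n → X, (∀ i ∈ α, x i = y i) → bf α x = bf α y)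
    -- admissibility with all parameters equal to 1:
    (κ : ℝ)
    (hadm : ∀ x : Fin n → X, f x = κ + ∑ i, bv i (x i) +
      ∑ α ∈ A, (bf α x - ∑ k ∈ α, bv k (x k)))
    -- min-consistency:
    (hmc : ∀ α ∈ A, ∀ i ∈ α, ∃ κ' : ℝ, ∀ t : X,
      sInf {r : ℝ | ∃ x : Fin n → X, x i = t ∧ bf α x = r} = κ' + bv i t)
    -- `xs` is a unique estimate for the beliefs:
    (xs : Fin n → X)
    (hxs : ∀ i : Fin n, ∀ y : X, y ≠ xs i → bv i (xs i) < bv i y) :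
    ∀ x : Fin n → X, f xs ≤ f x := by
  intro x
  rcases isEmpty_or_nonempty (Fin n) with hn | ⟨⟨r⟩⟩
  · rw [Subsingleton.elim xs x]
  obtain ⟨p, hp, hr, huniq⟩ := exists_parent_of_isTree hTree
    (by simp [SimpleGraph.fromRel_adj]) (by simp [SimpleGraph.fromRel_adj])
    (by simp [SimpleGraph.fromRel_adj]) r
  have hf_root : ∀ y, f y = κ + bv r (y r) + ∑ α ∈ A, (bf α y - bv (p α) (y (p α))) := by
    intro y
    have := sum_add_sum_parent_eq A r p hp hr huniq fun i => bv i (y i)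
    rw [hadm, Finset.sum_sub_distrib, Finset.sum_sub_distrib]
    linarith
  rw [hf_root, hf_root]
  have hroot : bv r (xs r) ≤ bv r (x r) := by
    by_cases h : x r = xs r
    · rw [h]
    · exact (hxs r _ h).le
  have hfactor : ∀ α ∈ A, bf α xs - bv (p α) (xs (p α)) ≤ bf α x - bv (p α) (x (p α)) := by
    intro α hα
    obtain ⟨c, hc⟩ := hmc α hα (p α) (hp α hα)
    obtain ⟨z, -, hz⟩ := exists_eq_const_add_of_sInf_eq hc (xs (p α))
    have := const_add_le_of_sInf_eq hc x
    have := le_of_minConsistent (hbfdep α hα) (hmc α hα) hxs z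
    linarith
  linarith [Finset.sum_le_sum hfactor]
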